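/- Let k be a field of characteristic not 2 and n ≥ 1, and let A, B ∈ Sp(2n,k) satisfy A² = I and B² = I. Then there exists Q ∈ Sp(2n,k) with Q⁻¹AQ = B or Q⁻¹AQ = -B if and only if the dimension of the eigenspace E(A,1) = ker(A - I) equals the dimension of E(B,1) = ker(B - I) or equals the dimension of E(B,-1) = ker(B + I). -/

import Mathlib

open Matrix

/-- The standard symplectic form matrix `J = [[0, Iₙ], [-Iₙ, 0]]`. -/
def SpJ (n : ℕ) (R : Type*) [CommRing R] : Matrix (Fin n ⊕ Fin n) (Fin n ⊕ Fin n) R :=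
  Matrix.fromBlocks 0 1 (-1) 0

/-- `M` belongs to the symplectic group `Sp(2n,R)`, i.e. `Mᵀ J M = J`. -/
def IsSymp {n : ℕ} {R : Type*} [CommRing R]
    (M : Matrix (Fin n ⊕ Fin n) (Fin n ⊕ Fin n) R) : Prop :=
  Mᵀ * SpJ n R * M = SpJ n R

theorem SpJ_mul_self (n : ℕ) (R : Type*) [CommRing R] : SpJ n R * SpJ n R = -1 := by
  simp [SpJ, Matrix.fromBlocks_multiply, ← Matrix.fromBlocks_one, Matrix.fromBlocks_neg]

theorem IsSymp.isUnit_det {n : ℕ} {R : Type*} [CommRing R]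
    {M : Matrix (Fin n ⊕ Fin n) (Fin n ⊕ Fin n) R} (hM : IsSymp M) : IsUnit M.det := by
  have h : (-(SpJ n R * Mᵀ * SpJ n R)) * M = 1 := by
    have hM' : Mᵀ * SpJ n R * M = SpJ n R := hM
    rw [Matrix.neg_mul, Matrix.mul_assoc, Matrix.mul_assoc, ← Matrix.mul_assoc Mᵀ, hM',
      SpJ_mul_self, neg_neg]
  exact Matrix.isUnit_det_of_left_inverse h

theorem IsSymp.neg {n : ℕ} {R : Type*} [CommRing R]
    {M : Matrix (Fin n ⊕ Fin n) (Fin n ⊕ Fin n) R} (hM : IsSymp M) : IsSymp (-M) := by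
  simpa [IsSymp] using hM

theorem ker_mulVecLin_neg {k m : Type*} [Field k] [Fintype m] (M : Matrix m m k) :
    LinearMap.ker (-M).mulVecLin = LinearMap.ker M.mulVecLin := by
  ext
  simp

/-- The kernel of a matrix and of its product with invertible matrices have equal dimension. -/
theorem finrank_ker_mulVecLin_mul_mul {k m : Type*} [Field k] [Fintype m] [DecidableEq m]
    (P M Q : Matrix m m k) (hP : IsUnit P.det) (hQ : IsUnit Q.det) :
    Module.finrank k (LinearMap.ker (P * M * Q).mulVecLin) =
      Module.finrank k (LinearMap.ker M.mulVecLin) := by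
  have h₁ := LinearMap.finrank_range_add_finrank_ker (P * M * Q).mulVecLin
  have h₂ := LinearMap.finrank_range_add_finrank_ker M.mulVecLin
  have h₃ : (P * M * Q).rank = M.rank := by
    rw [Matrix.rank_mul_eq_left_of_isUnit_det _ _ hQ, Matrix.rank_mul_eq_right_of_isUnit_det _ _ hP]
  simp only [Matrix.rank] at h₃
  omega

section Glue

variable {k V W : Type*} [Field k] [AddCommGroup V] [Module k V] [AddCommGroup W] [Module k W]

/-- Isometries between the summands of orthogonal decompositions glue to an isometry. -/
theorem exists_isometry_of_isCompl {ω : V →ₗ[k] V →ₗ[k] k} {η : W →ₗ[k] W →ₗ[k] k}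
    (hω : ω.IsAlt) (hη : η.IsAlt)
    {P Q : Submodule k V} {P' Q' : Submodule k W} (hPQ : IsCompl P Q) (hPQ' : IsCompl P' Q')
    (ho : ∀ p ∈ P, ∀ q ∈ Q, ω p q = 0) (ho' : ∀ p ∈ P', ∀ q ∈ Q', η p q = 0)
    (e : P ≃ₗ[k] P') (f : Q ≃ₗ[k] Q')
    (he : ∀ x y : P, η (e x) (e y) = ω x y) (hf : ∀ x y : Q, η (f x) (f y) = ω x y) :
    ∃ g : V ≃ₗ[k] W, (∀ x y, η (g x) (g y) = ω x y) ∧ (∀ x : P, g x = e x) ∧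
      ∀ x : Q, g x = f x := by
  set g : V ≃ₗ[k] W := (Submodule.prodEquivOfIsCompl P Q hPQ).symm ≪≫ₗ
    (e.prodCongr f) ≪≫ₗ Submodule.prodEquivOfIsCompl P' Q' hPQ' with hg
  have hgP : ∀ x : P, g x = e x := fun x ↦ by simp [hg]
  have hgQ : ∀ x : Q, g x = f x := fun x ↦ by simp [hg]
  refine ⟨g, fun x y ↦ ?_, hgP, hgQ⟩
  have hdec : ∀ z : V, ∃ (p : P) (q : Q), z = p + q := fun z ↦
    ⟨_, _, ((Submodule.prodEquivOfIsCompl P Q hPQ).apply_symm_apply z).symm⟩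
  obtain ⟨p, q, rfl⟩ := hdec x
  obtain ⟨p', q', rfl⟩ := hdec y
  have h₁ : ω q p' = 0 := by rw [← hω.neg, ho _ p'.2 _ q.2, neg_zero]
  have h₂ : η (f q) (e p') = 0 := by rw [← hη.neg, ho' _ (e p').2 _ (f q).2, neg_zero]
  simp only [map_add, LinearMap.add_apply, hgP, hgQ, he, hf, h₁, h₂, ho _ p.2 _ q'.2,
    ho' _ (e p).2 _ (f q').2]

/-- An orthogonal complement in a nondegenerate alternating space is nondegenerate. -/
theorem nondegenerate_of_isCompl {ω : V →ₗ[k] V →ₗ[k] k} (hω : ω.IsAlt)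
    (hnd : ∀ x, (∀ y, ω x y = 0) → x = 0) {P Q : Submodule k V} (hPQ : IsCompl P Q)
    (ho : ∀ p ∈ P, ∀ q ∈ Q, ω p q = 0) (x : Q) (hx : ∀ y : Q, ω x y = 0) : x = 0 := by
  refine Subtype.ext (hnd x fun y ↦ ?_)
  obtain ⟨p, hp, q, hq, rfl⟩ := Submodule.mem_sup.1 (hPQ.sup_eq_top ▸ Submodule.mem_top (x := y))
  rw [map_add, ← hω.neg, ho p hp x x.2, hx ⟨q, hq⟩, neg_zero, add_zero]

/-- A nonzero nondegenerate alternating space splits off a hyperbolic plane. -/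
theorem exists_hyperbolic_plane [Nontrivial V] {ω : V →ₗ[k] V →ₗ[k] k} (hω : ω.IsAlt)
    (hnd : ∀ x, (∀ y, ω x y = 0) → x = 0) :
    ∃ (h : k × k →ₗ[k] V) (N : Submodule k V), Function.Injective h ∧
      (∀ a b, ω (h a) (h b) = a.1 * b.2 - a.2 * b.1) ∧ IsCompl (LinearMap.range h) N ∧
      ∀ p ∈ LinearMap.range h, ∀ q ∈ N, ω p q = 0 := by
  obtain ⟨v, hv⟩ := exists_ne (0 : V)
  obtain ⟨u, hvu⟩ : ∃ u, ω v u = 1 := by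
    obtain ⟨y, hy⟩ : ∃ y, ω v y ≠ 0 := by
      by_contra! h
      exact hv (hnd v h)
    exact ⟨(ω v y)⁻¹ • y, by simp [hy]⟩
  have huv : ω u v = -1 := by rw [← hω.neg, hvu]
  have hvv : ω v v = 0 := hω v
  have huu : ω u u = 0 := hω u
  have hform : ∀ a b : k × k, ω (a.1 • v + a.2 • u) (b.1 • v + b.2 • u) =
      a.1 * b.2 - a.2 * b.1 := fun a b ↦ by
    simp [hvu, huv, hvv, huu]; ring
  set h : k × k →ₗ[k] V :=
    (LinearMap.toSpanSingleton k V v).coprod (LinearMap.toSpanSingleton k V u) with hh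
  have happ : ∀ a, h a = a.1 • v + a.2 • u := fun a ↦ by simp [hh]
  refine ⟨h, LinearMap.ker (ω v) ⊓ LinearMap.ker (ω u), ?_, fun a b ↦ ?_, ⟨?_, ?_⟩, ?_⟩
  · refine (injective_iff_map_eq_zero h).2 fun a ha ↦ ?_
    rw [happ] at ha
    have h₁ := hform a (0, 1)
    have h₂ := hform a (1, 0)
    rw [ha] at h₁ h₂
    ext
    · simpa using h₁.symm
    · simpa using h₂.symm
  · rw [happ, happ, hform]
  · rw [Submodule.disjoint_def]
    rintro _ ⟨a, rfl⟩ ⟨h₁, h₂⟩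
    rw [happ] at h₁ h₂ ⊢
    simp [hvu, huv, hvv, huu] at h₁ h₂
    simp [h₁, h₂]
  · rw [codisjoint_iff, eq_top_iff]
    intro x _
    refine Submodule.mem_sup.2 ⟨h (-(ω u x), ω v x), ⟨_, rfl⟩, x - h (-(ω u x), ω v x), ?_, by abel⟩
    rw [happ]
    constructor <;> simp [hvu, huv, hvv, huu]
  · rintro _ ⟨a, rfl⟩ q ⟨h₁, h₂⟩
    rw [happ]
    simp_all

end Glue

/-- Nondegenerate alternating spaces of equal finite dimension are isometric. -/
theorem exists_isometry_of_finrank_eq {k : Type*} [Field k] (d : ℕ) {V W : Type*}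
    [AddCommGroup V] [Module k V] [FiniteDimensional k V]
    [AddCommGroup W] [Module k W] [FiniteDimensional k W]
    {ω : V →ₗ[k] V →ₗ[k] k} {η : W →ₗ[k] W →ₗ[k] k} (hω : ω.IsAlt) (hη : η.IsAlt)
    (hnd : ∀ x, (∀ y, ω x y = 0) → x = 0) (hnd' : ∀ x, (∀ y, η x y = 0) → x = 0)
    (hV : Module.finrank k V = d) (hW : Module.finrank k W = d) :
    ∃ g : V ≃ₗ[k] W, ∀ x y, η (g x) (g y) = ω x y := by
  induction d using Nat.strong_induction_on generalizing V W with
  | _ d ih =>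
    rcases Nat.eq_zero_or_pos d with rfl | hd
    · have := Module.finrank_zero_iff.1 hV
      refine ⟨LinearEquiv.ofFinrankEq V W (hV.trans hW.symm), fun x y ↦ ?_⟩
      simp [Subsingleton.elim x 0]
    · have := Module.nontrivial_of_finrank_pos (hV ▸ hd)
      have := Module.nontrivial_of_finrank_pos (hW ▸ hd)
      obtain ⟨h, N, hinj, hform, hc, ho⟩ := exists_hyperbolic_plane hω hnd
      obtain ⟨h', N', hinj', hform', hc', ho'⟩ := exists_hyperbolic_plane hη hnd'
      have h₁ := Submodule.finrank_add_eq_of_isCompl hc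
      have h₂ := Submodule.finrank_add_eq_of_isCompl hc'
      rw [LinearMap.finrank_range_of_inj hinj] at h₁
      rw [LinearMap.finrank_range_of_inj hinj'] at h₂
      simp only [Module.finrank_prod, Module.finrank_self] at h₁ h₂
      obtain ⟨f, hf⟩ := ih (d - 2) (by omega) (ω := ω.domRestrict₁₂ N N)
        (η := η.domRestrict₁₂ N' N') (fun x ↦ hω x) (fun x ↦ hη x)
        (nondegenerate_of_isCompl hω hnd hc ho) (nondegenerate_of_isCompl hη hnd' hc' ho')
        (by omega) (by omega)
      obtain ⟨g, hg, -⟩ := exists_isometry_of_isCompl hω hη hc hc' ho ho'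
        ((LinearEquiv.ofInjective h hinj).symm ≪≫ₗ LinearEquiv.ofInjective h' hinj') f
        (fun x y ↦ by
          obtain ⟨a, rfl⟩ := (LinearEquiv.ofInjective h hinj).surjective x
          obtain ⟨b, rfl⟩ := (LinearEquiv.ofInjective h hinj).surjective y
          simp [hform, hform'])
        hf
      exact ⟨g, hg⟩

/-- The `±1`-eigenspaces of a matrix involution are complementary. -/
theorem isCompl_ker_sub_one_ker_add_one {k m : Type*} [Field k] [Fintype m] [DecidableEq m]
    (hchar : (2 : k) ≠ 0) {A : Matrix m m k} (hA : A * A = 1) :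
    IsCompl (LinearMap.ker (A - 1).mulVecLin) (LinearMap.ker (A + 1).mulVecLin) := by
  constructor
  · rw [Submodule.disjoint_def]
    intro x h₁ h₂
    simp only [LinearMap.mem_ker, Matrix.mulVecLin_apply, Matrix.sub_mulVec, Matrix.add_mulVec,
      Matrix.one_mulVec] at h₁ h₂
    have h : (2 : k) • x = 0 := by
      have hx : x + x = A *ᵥ x + x - (A *ᵥ x - x) := by abel
      rw [two_smul, hx, h₁, h₂, sub_zero]
    exact (smul_eq_zero.1 h).resolve_left hchar
  · rw [codisjoint_iff, eq_top_iff]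
    intro x _
    have hx : A *ᵥ (A *ᵥ x) = x := by rw [Matrix.mulVec_mulVec, hA, Matrix.one_mulVec]
    refine Submodule.mem_sup.2 ⟨(2 : k)⁻¹ • (x + A *ᵥ x), ?_, (2 : k)⁻¹ • (x - A *ᵥ x), ?_, ?_⟩
    · simp [Matrix.mulVec_smul, Matrix.mulVec_add, hx, add_comm]
    · simp [Matrix.mulVec_sub, hx]
    · rw [← smul_add, add_add_sub_cancel, ← two_smul k, smul_smul, inv_mul_cancel₀ hchar, one_smul]

/-- The standard symplectic form on `k²ⁿ`. -/
noncomputable def spForm (n : ℕ) (k : Type*) [Field k] :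
    (Fin n ⊕ Fin n → k) →ₗ[k] (Fin n ⊕ Fin n → k) →ₗ[k] k :=
  Matrix.toLinearMap₂' k (SpJ n k)

theorem spForm_apply {n : ℕ} {k : Type*} [Field k] (x y : Fin n ⊕ Fin n → k) :
    spForm n k x y = x ⬝ᵥ SpJ n k *ᵥ y :=
  Matrix.toLinearMap₂'_apply' _ _ _

/-- The symplectic form on `k²ⁿ` is alternating. -/
theorem isAlt_spForm (n : ℕ) (k : Type*) [Field k] :
    (spForm n k).IsAlt := fun x ↦ by
  rw [spForm_apply, SpJ, Matrix.fromBlocks_mulVec]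
  simp [dotProduct, Fintype.sum_sum_type, Matrix.neg_mulVec, mul_comm]

theorem eq_zero_of_spForm {n : ℕ} {k : Type*} [Field k] (x : Fin n ⊕ Fin n → k)
    (hx : ∀ y, spForm n k x y = 0) : x = 0 := by
  refine dotProduct_eq_zero _ fun y ↦ ?_
  have := hx (-(SpJ n k *ᵥ y))
  rwa [spForm_apply, Matrix.mulVec_neg, Matrix.mulVec_mulVec, SpJ_mul_self,
    Matrix.neg_mulVec, neg_neg, Matrix.one_mulVec] at this

theorem IsSymp.spForm_mulVec {n : ℕ} {k : Type*} [Field k]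
    {M : Matrix (Fin n ⊕ Fin n) (Fin n ⊕ Fin n) k} (hM : IsSymp M) (x y : Fin n ⊕ Fin n → k) :
    spForm n k (M *ᵥ x) (M *ᵥ y) = spForm n k x y := by
  have hM' : Mᵀ * SpJ n k * M = SpJ n k := hM
  conv_rhs => rw [spForm_apply, ← hM']
  simp only [spForm_apply, ← Matrix.mulVec_mulVec, Matrix.dotProduct_mulVec x Mᵀ,
    Matrix.vecMul_transpose]

theorem isSymp_of_spForm_mulVec {n : ℕ} {k : Type*} [Field k]
    {M : Matrix (Fin n ⊕ Fin n) (Fin n ⊕ Fin n) k}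
    (hM : ∀ x y, spForm n k (M *ᵥ x) (M *ᵥ y) = spForm n k x y) : IsSymp M := by
  refine Matrix.ext_of_mulVec_single fun i ↦ dotProduct_eq _ _ fun x ↦ ?_
  have h := hM x (Pi.single i 1)
  rw [dotProduct_comm, dotProduct_comm _ x, ← spForm_apply, ← h]
  simp only [spForm_apply, ← Matrix.mulVec_mulVec, Matrix.dotProduct_mulVec x Mᵀ,
    Matrix.vecMul_transpose]

/-- The `±1`-eigenspaces of a symplectic involution are orthogonal. -/
theorem IsSymp.spForm_eq_zero {n : ℕ} {k : Type*} [Field k] (hchar : (2 : k) ≠ 0)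
    {A : Matrix (Fin n ⊕ Fin n) (Fin n ⊕ Fin n) k} (hA : IsSymp A)
    (p : Fin n ⊕ Fin n → k) (hp : p ∈ LinearMap.ker (A - 1).mulVecLin)
    (q : Fin n ⊕ Fin n → k) (hq : q ∈ LinearMap.ker (A + 1).mulVecLin) :
    spForm n k p q = 0 := by
  simp only [LinearMap.mem_ker, Matrix.mulVecLin_apply, Matrix.sub_mulVec, Matrix.add_mulVec,
    Matrix.one_mulVec] at hp hq
  have h := hA.spForm_mulVec p q
  rw [sub_eq_zero.1 hp, eq_neg_of_add_eq_zero_left hq, map_neg] at h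
  refine (mul_eq_zero.1 ?_).resolve_left hchar
  linear_combination -h

/-- Symplectic involutions with `1`-eigenspaces of equal dimension are symplectically conjugate. -/
theorem exists_isSymp_conj_of_finrank_eq {n : ℕ} {k : Type*} [Field k] (hchar : (2 : k) ≠ 0)
    {A B : Matrix (Fin n ⊕ Fin n) (Fin n ⊕ Fin n) k}
    (hA : IsSymp A) (hB : IsSymp B) (hA2 : A * A = 1) (hB2 : B * B = 1)
    (h : Module.finrank k (LinearMap.ker (A - 1).mulVecLin) =
      Module.finrank k (LinearMap.ker (B - 1).mulVecLin)) :
    ∃ Q : Matrix (Fin n ⊕ Fin n) (Fin n ⊕ Fin n) k, IsSymp Q ∧ Q⁻¹ * A * Q = B := by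
  have hcA := isCompl_ker_sub_one_ker_add_one hchar hA2
  have hcB := isCompl_ker_sub_one_ker_add_one hchar hB2
  have hoA := hA.spForm_eq_zero hchar
  have hoB := hB.spForm_eq_zero hchar
  have halt := isAlt_spForm n k
  have hflip : ∀ {P Q : Submodule k (Fin n ⊕ Fin n → k)},
      (∀ p ∈ P, ∀ q ∈ Q, spForm n k p q = 0) →
      ∀ q ∈ Q, ∀ p ∈ P, spForm n k q p = 0 :=
    fun ho q hq p hp ↦ by rw [← halt.neg, ho p hp q hq, neg_zero]
  have h' : Module.finrank k (LinearMap.ker (A + 1).mulVecLin) =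
      Module.finrank k (LinearMap.ker (B + 1).mulVecLin) := by
    have h₁ := Submodule.finrank_add_eq_of_isCompl hcA
    have h₂ := Submodule.finrank_add_eq_of_isCompl hcB
    omega
  obtain ⟨e, he⟩ := exists_isometry_of_finrank_eq _
    (ω := (spForm n k).domRestrict₁₂ (LinearMap.ker (B - 1).mulVecLin)
      (LinearMap.ker (B - 1).mulVecLin))
    (η := (spForm n k).domRestrict₁₂ (LinearMap.ker (A - 1).mulVecLin)
      (LinearMap.ker (A - 1).mulVecLin))
    (fun x ↦ halt x) (fun x ↦ halt x)
    (nondegenerate_of_isCompl halt eq_zero_of_spForm hcB.symm (hflip hoB))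
    (nondegenerate_of_isCompl halt eq_zero_of_spForm hcA.symm (hflip hoA)) rfl h
  obtain ⟨f, hf⟩ := exists_isometry_of_finrank_eq _
    (ω := (spForm n k).domRestrict₁₂ (LinearMap.ker (B + 1).mulVecLin)
      (LinearMap.ker (B + 1).mulVecLin))
    (η := (spForm n k).domRestrict₁₂ (LinearMap.ker (A + 1).mulVecLin)
      (LinearMap.ker (A + 1).mulVecLin))
    (fun x ↦ halt x) (fun x ↦ halt x)
    (nondegenerate_of_isCompl halt eq_zero_of_spForm hcB hoB)
    (nondegenerate_of_isCompl halt eq_zero_of_spForm hcA hoA) rfl h'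
  obtain ⟨g, hg, hge, hgf⟩ := exists_isometry_of_isCompl halt halt hcB hcA hoB hoA e f he hf
  have hQ : ∀ x, LinearMap.toMatrix' g.toLinearMap *ᵥ x = g x := fun x ↦ by
    rw [LinearMap.toMatrix'_mulVec, LinearEquiv.coe_coe]
  have hS : IsSymp (LinearMap.toMatrix' g.toLinearMap) :=
    isSymp_of_spForm_mulVec fun x y ↦ by rw [hQ, hQ, hg]
  refine ⟨_, hS, ?_⟩
  have hconj : A * LinearMap.toMatrix' g.toLinearMap = LinearMap.toMatrix' g.toLinearMap * B := by
    refine Matrix.ext_of_mulVec_single fun i ↦ ?_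
    generalize (Pi.single i 1 : Fin n ⊕ Fin n → k) = x
    rw [← Matrix.mulVec_mulVec, ← Matrix.mulVec_mulVec, hQ, hQ]
    obtain ⟨p, hp, q, hq, rfl⟩ :=
      Submodule.mem_sup.1 (hcB.sup_eq_top ▸ Submodule.mem_top (x := x))
    have hp' := (e ⟨p, hp⟩).2
    have hq' := (f ⟨q, hq⟩).2
    rw [← hge] at hp'
    rw [← hgf] at hq'
    simp only [LinearMap.mem_ker, Matrix.mulVecLin_apply, Matrix.sub_mulVec, Matrix.add_mulVec,
      Matrix.one_mulVec, sub_eq_zero, add_eq_zero_iff_eq_neg] at hp hq hp' hq'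
    simp only [map_add, Matrix.mulVec_add, hp, hq, hp', hq', map_neg]
  rw [Matrix.mul_assoc, hconj, Matrix.nonsing_inv_mul_cancel_left _ _ hS.isUnit_det]

/-- For `A, B ∈ Sp(2n,k)` with `A² = I = B²`: `A` is symplectically conjugate to `B` or `-B`
iff `dim E(A,1)` equals `dim E(B,1)` or `dim E(B,-1)`. -/
theorem stmt6 {k : Type*} [Field k] (hchar : (2 : k) ≠ 0) {n : ℕ} (hn : 1 ≤ n)
    (A B : Matrix (Fin n ⊕ Fin n) (Fin n ⊕ Fin n) k)
    (hA : IsSymp A) (hB : IsSymp B) (hA2 : A * A = 1) (hB2 : B * B = 1) :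
    (∃ Q : Matrix (Fin n ⊕ Fin n) (Fin n ⊕ Fin n) k, IsSymp Q ∧
        (Q⁻¹ * A * Q = B ∨ Q⁻¹ * A * Q = -B)) ↔
      (Module.finrank k (LinearMap.ker (A - 1).mulVecLin)
          = Module.finrank k (LinearMap.ker (B - 1).mulVecLin) ∨
       Module.finrank k (LinearMap.ker (A - 1).mulVecLin)
          = Module.finrank k (LinearMap.ker (B + 1).mulVecLin)) := by
  constructor
  · rintro ⟨Q, hQ, hAB⟩
    have hQd := hQ.isUnit_det
    have hker := finrank_ker_mulVecLin_mul_mul Q⁻¹ (A - 1) Q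
      (Matrix.isUnit_nonsing_inv_det Q hQd) hQd
    rw [Matrix.mul_sub, Matrix.sub_mul, Matrix.mul_one, Matrix.nonsing_inv_mul Q hQd] at hker
    rcases hAB with hAB | hAB
    · left
      rw [← hker, hAB]
    · right
      rw [← hker, hAB, ← neg_add', ker_mulVecLin_neg]
  · rintro (h | h)
    · obtain ⟨Q, hQ, hAB⟩ := exists_isSymp_conj_of_finrank_eq hchar hA hB hA2 hB2 h
      exact ⟨Q, hQ, Or.inl hAB⟩
    · obtain ⟨Q, hQ, hAB⟩ := exists_isSymp_conj_of_finrank_eq hchar hA hB.neg hA2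
        (by rwa [neg_mul_neg])
        (by rwa [← neg_add', ker_mulVecLin_neg])
      exact ⟨Q, hQ, Or.inr hAB⟩
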